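/- Degree principle for symmetric polynomial optimization: let f, g_1, …, g_m ∈ ℝ[X_1, …, X_n] be symmetric polynomials (invariant under all permutations of the variables), set r := max{2, ⌊deg(f)/2⌋, deg(g_1), …, deg(g_m)}, and let K := {x ∈ ℝ^n : g_1(x) ≥ 0, …, g_m(x) ≥ 0}. Then inf_{x ∈ K} f(x) = inf_{x ∈ K ∩ A_r} f(x), where A_r := {x ∈ ℝ^n : x has at most r distinct coordinates}; moreover, if the set of minimizers of f on K is nonempty, it contains at least one point of A_r. -/

import Mathlib

open MvPolynomial

theorem shift_roots {ι : Type*} (I : Finset ι) (hI : I.Nonempty) (y : ι → ℝ)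
    (hy : Set.InjOn y I) :
    ∀ᶠ c in nhds (0:ℝ), ∃ x : ι → ℝ, ∏ i ∈ I, (Polynomial.X - Polynomial.C (x i)) =
      ∏ i ∈ I, (Polynomial.X - Polynomial.C (y i)) - Polynomial.C c := by
  set Q : Polynomial ℝ := ∏ i ∈ I, (Polynomial.X - Polynomial.C (y i)) with hQ
  have hsep : Q.Separable :=
    Polynomial.separable_prod_X_sub_C_iff'.2 (fun a ha b hb h => hy ha hb h)
  have hroot : ∀ i ∈ I, Q.eval (y i) = 0 := by
    intro i hi
    rw [hQ, Polynomial.eval_prod]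
    exact Finset.prod_eq_zero hi (by simp)
  obtain ⟨U, hU, hdisj⟩ := (I.finite_toSet.image y).t2_separation
  have key : ∀ i ∈ I, ∀ᶠ c in nhds (0:ℝ), ∃ x ∈ U (y i), Q.eval x = c := by
    intro i hi
    have hd : Q.derivative.eval (y i) ≠ 0 :=
      hsep.eval₂_derivative_ne_zero (RingHom.id ℝ) (hroot i hi)
    have h1 := (Q.hasStrictDerivAt (y i)).map_nhds_eq hd
    rw [hroot i hi] at h1
    have h2 := Filter.image_mem_map (m := fun x => Q.eval x) ((hU (y i)).2.mem_nhds (hU (y i)).1)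
    rw [h1] at h2
    filter_upwards [h2] with c hc
    exact hc
  have key2 := (Filter.eventually_all_finset I).2 key
  filter_upwards [key2] with c hc
  choose! x hxU hx using hc
  refine ⟨x, ?_⟩
  have hinj : Set.InjOn x I := by
    intro a ha b hb hab
    by_contra hne
    have := hdisj (Set.mem_image_of_mem y ha) (Set.mem_image_of_mem y hb)
      (fun h => hne (hy ha hb h))
    refine Set.disjoint_left.1 this (hxU a ha) ?_
    rw [hab]; exact hxU b hb
  have hdeg : ∀ z : ι → ℝ, (∏ i ∈ I, (Polynomial.X - Polynomial.C (z i))).degree = (I.card : WithBot ℕ) := by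
    intro z
    rw [Polynomial.degree_prod]; simp
  have hmon : ∀ z : ι → ℝ, (∏ i ∈ I, (Polynomial.X - Polynomial.C (z i))).Monic := fun z =>
    Polynomial.monic_prod_of_monic _ _ fun i _ => Polynomial.monic_X_sub_C _
  have hpos : (0 : WithBot ℕ) < I.card := by exact_mod_cast hI.card_pos
  have hcdeg : (Polynomial.C c).degree < Q.degree := by
    rw [hdeg]; exact lt_of_le_of_lt Polynomial.degree_C_le hpos
  refine Polynomial.eq_of_degree_sub_lt_of_eval_index_eq I hinj ?_ ?_
  · rw [← hdeg x]
    refine Polynomial.degree_sub_lt_left ?_ (hmon x).ne_zero ?_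
    · rw [Polynomial.degree_sub_eq_left_of_degree_lt hcdeg, hdeg, hdeg]
    · rw [(hmon x).leadingCoeff, Polynomial.leadingCoeff_sub_of_degree_lt hcdeg]
      exact (hmon y).leadingCoeff.symm
  · intro i hi
    rw [Polynomial.eval_sub, hx i hi, Polynomial.eval_prod]
    simp [Finset.prod_eq_zero hi]

theorem esymm_eq_coeff {n : ℕ} (y : Fin n → ℝ) (i : Fin n) :
    eval y (esymm (Fin n) ℝ (i + 1)) = (-1) ^ (i.1 + 1) *
      (∏ j, (Polynomial.X - Polynomial.C (y j))).coeff (n - (i.1 + 1)) := by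
  have h1 := Multiset.prod_X_sub_C_coeff (Finset.univ.val.map y) (k := n - (i.1 + 1)) (by simp)
  have h2 : Multiset.card (Finset.univ.val.map y) - (n - (i.1+1)) = i.1 + 1 := by
    simp; omega
  rw [h2, Multiset.map_map] at h1
  have h3 : eval y (esymm (Fin n) ℝ (i + 1)) = (Finset.univ.val.map y).esymm (i.1+1) := by
    rw [← aeval_esymm_eq_multiset_esymm (Fin n) ℝ]; simp [aeval_eq_eval]
  have h4 : (∏ j, (Polynomial.X - Polynomial.C (y j))) = (Multiset.map ((fun t => Polynomial.X - Polynomial.C t) ∘ y) Finset.univ.val).prod := rfl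
  rw [h3, h4, h1, ← mul_assoc, ← pow_add, ← two_mul]
  simp

/-- Perturbation of a point with more than `r` distinct coordinates. -/
theorem perturb {n r : ℕ} (y : Fin n → ℝ)
    (h : r < (Finset.univ.image y).card) :
    ∃ (v : Fin n → ℝ) (yp ym : Fin n → ℝ), (∀ i, i.1 + 1 ≤ r → v i = 0) ∧ v ≠ 0 ∧
      (∀ i : Fin n, eval yp (esymm (Fin n) ℝ (i + 1)) = eval y (esymm (Fin n) ℝ (i + 1)) + v i) ∧
      (∀ i : Fin n, eval ym (esymm (Fin n) ℝ (i + 1)) = eval y (esymm (Fin n) ℝ (i + 1)) - v i) := by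
  classical
  obtain ⟨I, -, hinj, hIy⟩ := Finset.exists_subset_injOn_image_eq_of_surjOn
    (f := y) Set.univ (Finset.univ.image y) (by
      intro a ha; simpa using ha)
  have hcard : (Finset.univ.image y).card = I.card := by
    rw [← hIy]; exact Finset.card_image_of_injOn hinj
  rw [hcard] at h
  have hne : I.Nonempty := Finset.card_pos.1 (by omega)
  have hIn : I.card ≤ n := by simpa using Finset.card_le_univ I
  have hs := shift_roots I hne y hinj
  obtain ⟨δ, hδ, hball⟩ := Metric.eventually_nhds_iff.1 hs
  set c : ℝ := δ / 2 with hc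
  have hcpos : 0 < c := by positivity
  have hcδ : c < δ := by linarith
  obtain ⟨xm, hxm⟩ := hball (y := c) (by simpa [abs_of_pos hcpos] using hcδ)
  obtain ⟨xp, hxp⟩ := hball (y := -c) (by simpa [abs_of_pos hcpos] using hcδ)
  set S : Polynomial ℝ := ∏ i ∈ Iᶜ, (Polynomial.X - Polynomial.C (y i)) with hS
  have hSdeg : S.natDegree = n - I.card := by
    rw [hS, Polynomial.natDegree_finsetProd_X_sub_C_eq_card, Finset.card_compl, Fintype.card_fin]
  have hSmon : S.Monic := Polynomial.monic_prod_of_monic _ _ fun i _ => Polynomial.monic_X_sub_C _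
  have hmod : ∀ (x : Fin n → ℝ) (d : ℝ), ∏ i ∈ I, (Polynomial.X - Polynomial.C (x i)) =
      ∏ i ∈ I, (Polynomial.X - Polynomial.C (y i)) - Polynomial.C d →
      ∏ i, (Polynomial.X - Polynomial.C (if i ∈ I then x i else y i)) =
        ∏ i, (Polynomial.X - Polynomial.C (y i)) - Polynomial.C d * S := by
    intro x d hx
    rw [← Finset.prod_mul_prod_compl I, ← Finset.prod_mul_prod_compl I (fun i => Polynomial.X - Polynomial.C (y i)), ← hS]
    have e1 : ∏ i ∈ I, (Polynomial.X - Polynomial.C (if i ∈ I then x i else y i)) =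
        ∏ i ∈ I, (Polynomial.X - Polynomial.C (x i)) :=
      Finset.prod_congr rfl fun i hi => by rw [if_pos hi]
    have e2 : ∏ i ∈ Iᶜ, (Polynomial.X - Polynomial.C (if i ∈ I then x i else y i)) = S :=
      Finset.prod_congr rfl fun i hi => by rw [if_neg (Finset.mem_compl.1 hi)]
    rw [e1, e2, hx, sub_mul]
  refine ⟨fun i => (-1) ^ (i.1 + 1) * (c * S.coeff (n - (i.1 + 1))),
    fun i => if i ∈ I then xp i else y i, fun i => if i ∈ I then xm i else y i, ?_, ?_, ?_, ?_⟩
  · intro i hi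
    have : S.coeff (n - (i.1 + 1)) = 0 :=
      Polynomial.coeff_eq_zero_of_natDegree_lt (by rw [hSdeg]; omega)
    simp [this]
  · intro h0
    have hp := hne.card_pos
    have h1 := congrFun h0 ⟨I.card - 1, by omega⟩
    have h2 : n - (I.card - 1 + 1) = S.natDegree := by rw [hSdeg]; omega
    simp only [h2, Polynomial.coeff_natDegree, hSmon.leadingCoeff] at h1
    simp [hcpos.ne'] at h1
  · intro i
    rw [esymm_eq_coeff, esymm_eq_coeff, hmod xp _ hxp]
    simp only [Polynomial.coeff_sub, Polynomial.coeff_C_mul]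
    ring
  · intro i
    rw [esymm_eq_coeff, esymm_eq_coeff, hmod xm _ hxm]
    simp only [Polynomial.coeff_sub, Polynomial.coeff_C_mul]
    ring

/-- Degree-aware fundamental theorem of symmetric polynomials, evaluated. -/
theorem symm_repr {n : ℕ} (f : MvPolynomial (Fin n) ℝ) (hf : f.IsSymmetric) :
    ∃ (S : Finset (Fin n →₀ ℕ)) (c : (Fin n →₀ ℕ) → ℝ),
      (∀ s ∈ S, ∑ i : Fin n, (i.1 + 1) * s i ≤ f.totalDegree) ∧
      ∀ y, eval y f = ∑ s ∈ S, c s * ∏ i : Fin n, (eval y (esymm (Fin n) ℝ (i + 1))) ^ (s i) := by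
  classical
  obtain ⟨P, hP⟩ := esymmAlgHom_surjective ℝ (σ := Fin n) (n := n) (by simp) ⟨f, hf⟩
  have hP' : aeval (fun i : Fin n => esymm (Fin n) ℝ (i.1 + 1)) P = f := by
    rw [← esymmAlgHom_apply, hP]
  let T : (Fin n →₀ ℕ) → MvPolynomial (Fin n) ℝ := fun s =>
    C (P.coeff s) * ∏ i : Fin n, (esymm (Fin n) ℝ (i.1 + 1)) ^ (s i)
  let w : (Fin n →₀ ℕ) → ℕ := fun s => ∑ i : Fin n, (i.1 + 1) * s i
  have hT : ∀ s, (T s).IsHomogeneous (w s) := by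
    intro s
    have h1 : (∏ i : Fin n, (esymm (Fin n) ℝ (i.1 + 1)) ^ (s i)).IsHomogeneous (w s) := by
      refine IsHomogeneous.prod _ _ _ fun i _ => ?_
      refine IsHomogeneous.pow ?_ _
      refine IsHomogeneous.sum _ _ _ fun t ht => ?_
      have := IsHomogeneous.prod t (fun j => (X j : MvPolynomial (Fin n) ℝ)) (fun _ => 1)
        (fun j _ => isHomogeneous_X _ _)
      rw [Finset.mem_powersetCard] at ht
      simpa [ht.2] using this
    simpa using (isHomogeneous_C (Fin n) (P.coeff s)).mul h1
  have hsum : f = ∑ s ∈ P.support, T s := by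
    rw [← hP', aeval_def, eval₂_eq']; rfl
  have hf2 : f = ∑ s ∈ P.support with w s ≤ f.totalDegree, T s := by
    have h1 := sum_homogeneousComponent f
    have h2 : ∀ j, homogeneousComponent j f = ∑ s ∈ P.support, if j = w s then T s else 0 := by
      intro j
      conv_lhs => rw [hsum]
      rw [map_sum]
      exact Finset.sum_congr rfl fun s _ => homogeneousComponent_of_mem (hT s)
    simp_rw [h2] at h1
    rw [Finset.sum_comm] at h1
    conv_lhs => rw [← h1]
    rw [Finset.sum_filter]
    refine Finset.sum_congr rfl fun s _ => ?_
    rw [Finset.sum_ite_eq']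
    simp
  refine ⟨{s ∈ P.support | w s ≤ f.totalDegree}, fun s => P.coeff s, ?_, ?_⟩
  · intro s hs
    exact (Finset.mem_filter.1 hs).2
  · intro y
    conv_lhs => rw [hf2]
    simp [T, map_sum, map_prod]

theorem symm_const {n r : ℕ} (f : MvPolynomial (Fin n) ℝ) (hf : f.IsSymmetric)
    (hd : f.totalDegree ≤ r) (x y : Fin n → ℝ)
    (h : ∀ i : Fin n, i.1 + 1 ≤ r →
      eval x (esymm (Fin n) ℝ (i + 1)) = eval y (esymm (Fin n) ℝ (i + 1))) :
    eval x f = eval y f := by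
  obtain ⟨S, c, hS, hrep⟩ := symm_repr f hf
  rw [hrep, hrep]
  refine Finset.sum_congr rfl fun s hs => ?_
  congr 1
  refine Finset.prod_congr rfl fun i _ => ?_
  rcases Nat.eq_zero_or_pos (s i) with h0 | h0
  · simp [h0]
  · rw [h i]
    have h1 := Finset.single_le_sum (f := fun i : Fin n => (i.1 + 1) * s i)
      (fun _ _ => Nat.zero_le _) (Finset.mem_univ i)
    have h2 := hS s hs
    have h3 : i.1 + 1 ≤ (i.1 + 1) * s i := Nat.le_mul_of_pos_right _ h0
    omega

theorem symm_affine {n r : ℕ} (f : MvPolynomial (Fin n) ℝ) (hf : f.IsSymmetric)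
    (hd : f.totalDegree / 2 ≤ r) (y yp ym v : Fin n → ℝ)
    (hv : ∀ i, i.1 + 1 ≤ r → v i = 0)
    (hp : ∀ i : Fin n, eval yp (esymm (Fin n) ℝ (i + 1)) = eval y (esymm (Fin n) ℝ (i + 1)) + v i)
    (hm : ∀ i : Fin n, eval ym (esymm (Fin n) ℝ (i + 1)) = eval y (esymm (Fin n) ℝ (i + 1)) - v i) :
    eval yp f + eval ym f = 2 * eval y f := by
  classical
  obtain ⟨S, c, hS, hrep⟩ := symm_repr f hf
  rw [hrep, hrep, hrep, ← Finset.sum_add_distrib, Finset.mul_sum]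
  refine Finset.sum_congr rfl fun s hs => ?_
  simp_rw [hp, hm]
  have hw := hS s hs
  by_cases hex : ∃ k : Fin n, r < k.1 + 1 ∧ 0 < s k
  · obtain ⟨k, hk, hsk⟩ := hex
    have hsum : ∑ i : Fin n, (i.1 + 1) * s i =
      (k.1 + 1) * s k + ∑ i ∈ Finset.univ.erase k, (i.1 + 1) * s i :=
      (Finset.add_sum_erase _ _ (Finset.mem_univ k)).symm
    have hsk1 : s k = 1 := by
      by_contra hne
      have : (k.1 + 1) * 2 ≤ (k.1 + 1) * s k := Nat.mul_le_mul_left _ (by omega)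
      omega
    have hoth : ∀ i ∈ Finset.univ.erase k, s i = 0 ∨ v i = 0 := by
      intro i hi
      by_contra! hcon
      have hir : r < i.1 + 1 := by
        by_contra hle
        exact hcon.2 (hv i (by omega))
      have h1 := Finset.single_le_sum (f := fun i : Fin n => (i.1 + 1) * s i)
        (fun _ _ => Nat.zero_le _) hi
      have h3 : i.1 + 1 ≤ (i.1 + 1) * s i := Nat.le_mul_of_pos_right _ (by omega)
      rw [hsk1] at hsum
      omega
    rw [← Finset.mul_prod_erase Finset.univ _ (Finset.mem_univ k),
      ← Finset.mul_prod_erase Finset.univ _ (Finset.mem_univ k),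
      ← Finset.mul_prod_erase Finset.univ _ (Finset.mem_univ k)]
    have e1 : ∏ i ∈ Finset.univ.erase k, (eval y (esymm (Fin n) ℝ (i.1 + 1)) + v i) ^ s i =
        ∏ i ∈ Finset.univ.erase k, (eval y (esymm (Fin n) ℝ (i.1 + 1))) ^ s i :=
      Finset.prod_congr rfl fun i hi => by rcases hoth i hi with h | h <;> simp [h]
    have e2 : ∏ i ∈ Finset.univ.erase k, (eval y (esymm (Fin n) ℝ (i.1 + 1)) - v i) ^ s i =
        ∏ i ∈ Finset.univ.erase k, (eval y (esymm (Fin n) ℝ (i.1 + 1))) ^ s i :=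
      Finset.prod_congr rfl fun i hi => by rcases hoth i hi with h | h <;> simp [h]
    rw [e1, e2, hsk1]
    ring
  · push Not at hex
    have hoth : ∀ i, s i = 0 ∨ v i = 0 := by
      intro i
      by_cases hi : i.1 + 1 ≤ r
      · exact Or.inr (hv i hi)
      · exact Or.inl (Nat.le_zero.1 (hex i (by omega)))
    have e1 : ∏ i : Fin n, (eval y (esymm (Fin n) ℝ (i.1 + 1)) + v i) ^ s i =
        ∏ i : Fin n, (eval y (esymm (Fin n) ℝ (i.1 + 1))) ^ s i :=
      Finset.prod_congr rfl fun i hi => by rcases hoth i with h | h <;> simp [h]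
    have e2 : ∏ i : Fin n, (eval y (esymm (Fin n) ℝ (i.1 + 1)) - v i) ^ s i =
        ∏ i : Fin n, (eval y (esymm (Fin n) ℝ (i.1 + 1))) ^ s i :=
      Finset.prod_congr rfl fun i hi => by rcases hoth i with h | h <;> simp [h]
    rw [e1, e2]
    ring

theorem key_claim {n r : ℕ} (hr2 : 2 ≤ r) (f : MvPolynomial (Fin n) ℝ) (hf : f.IsSymmetric)
    (hd : f.totalDegree / 2 ≤ r) (x : Fin n → ℝ) :
    ∃ y : Fin n → ℝ, (Finset.univ.image y).card ≤ r ∧ eval y f ≤ eval x f ∧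
      ∀ i : Fin n, i.1 + 1 ≤ r →
        eval y (esymm (Fin n) ℝ (i + 1)) = eval x (esymm (Fin n) ℝ (i + 1)) := by
  classical
  let F : Set (Fin n → ℝ) := {y | ∀ i : Fin n, i.1 + 1 ≤ r →
        eval y (esymm (Fin n) ℝ (i + 1)) = eval x (esymm (Fin n) ℝ (i + 1))}
  have hcont : ∀ p : MvPolynomial (Fin n) ℝ, Continuous fun y : Fin n → ℝ => eval y p :=
    fun p => MvPolynomial.continuous_eval p
  have hxF : x ∈ F := fun _ _ => rfl
  have hclosed : IsClosed F := by
    have : F = ⋂ i : Fin n, ⋂ _ : i.1 + 1 ≤ r, {y | eval y (esymm (Fin n) ℝ (i + 1)) =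
        eval x (esymm (Fin n) ℝ (i + 1))} := by
      ext y; simp [F]
    rw [this]
    exact isClosed_iInter fun i => isClosed_iInter fun _ => isClosed_eq (hcont _) continuous_const
  have hpdeg : (psum (Fin n) ℝ 2).totalDegree ≤ r := by
    refine le_trans (IsHomogeneous.totalDegree_le (n := 2) ?_) hr2
    refine IsHomogeneous.sum _ _ _ fun i _ => ?_
    simpa using (isHomogeneous_X ℝ i).pow 2
  have hcomp : IsCompact F := by
    refine Metric.isCompact_of_isClosed_isBounded hclosed ?_
    refine (Metric.isBounded_closedBall (x := (0 : Fin n → ℝ))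
      (r := ∑ i, x i ^ 2 + 1)).subset ?_
    intro y hy
    have h1 := symm_const (psum (Fin n) ℝ 2) (psum_isSymmetric _ _ _) hpdeg y x hy
    simp only [psum, map_sum, map_pow, eval_X] at h1
    have hnn : 0 ≤ ∑ i, x i ^ 2 := Finset.sum_nonneg fun i _ => sq_nonneg _
    rw [mem_closedBall_zero_iff, pi_norm_le_iff_of_nonneg (by linarith)]
    intro i
    have h2 := Finset.single_le_sum (f := fun i => y i ^ 2) (fun i _ => sq_nonneg _)
      (Finset.mem_univ i)
    rw [Real.norm_eq_abs, abs_le]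
    constructor <;> nlinarith [sq_nonneg (y i - 1), sq_nonneg (y i + 1)]
  obtain ⟨y0, hy0F, hy0⟩ := hcomp.exists_isMinOn ⟨x, hxF⟩ (hcont f).continuousOn
  let M : Set (Fin n → ℝ) := F ∩ {y | eval y f = eval y0 f}
  have hMcomp : IsCompact M := hcomp.inter_right (isClosed_eq (hcont f) continuous_const)
  obtain ⟨y, hyM, hy⟩ := hMcomp.exists_isMaxOn ⟨y0, hy0F, rfl⟩
    (f := fun y => ∑ i : Fin n, (eval y (esymm (Fin n) ℝ (i + 1))) ^ 2)
    (continuous_finsetSum _ fun i _ => (hcont _).pow 2).continuousOn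
  refine ⟨y, ?_, ?_, hyM.1⟩
  · by_contra hlt
    obtain ⟨v, yp, ym, hv, hv0, hp, hm⟩ := perturb (r := r) y (by omega)
    have hpF : yp ∈ F := fun i hi => by rw [hp, hv i hi, add_zero]; exact hyM.1 i hi
    have hmF : ym ∈ F := fun i hi => by rw [hm, hv i hi, sub_zero]; exact hyM.1 i hi
    have haff := symm_affine f hf hd y yp ym v hv hp hm
    have hyf : eval y f = eval y0 f := hyM.2
    have h1 : eval y0 f ≤ eval yp f := hy0 hpF
    have h2 : eval y0 f ≤ eval ym f := hy0 hmF
    have hpM : yp ∈ M := ⟨hpF, show eval yp f = eval y0 f by linarith⟩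
    have hmM : ym ∈ M := ⟨hmF, show eval ym f = eval y0 f by linarith⟩
    have h3 := hy hpM
    have h4 := hy hmM
    simp only [Set.mem_ofPred_eq, hp, hm] at h3 h4
    have h5 : ∑ i : Fin n, (eval y (esymm (Fin n) ℝ (i.1 + 1)) + v i) ^ 2 +
        ∑ i : Fin n, (eval y (esymm (Fin n) ℝ (i.1 + 1)) - v i) ^ 2 =
        2 * ∑ i : Fin n, (eval y (esymm (Fin n) ℝ (i.1 + 1))) ^ 2 + 2 * ∑ i, v i ^ 2 := by
      rw [Finset.mul_sum, Finset.mul_sum, ← Finset.sum_add_distrib, ← Finset.sum_add_distrib]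
      exact Finset.sum_congr rfl fun i _ => by ring
    have h6 : 0 < ∑ i, v i ^ 2 := by
      obtain ⟨i, hi⟩ := Function.ne_iff.1 hv0
      exact Finset.sum_pos' (fun i _ => sq_nonneg _) ⟨i, Finset.mem_univ i, by
        have : v i ≠ 0 := hi
        positivity⟩
    linarith
  · have : eval y f = eval y0 f := hyM.2
    rw [this]; exact hy0 hxF

/-- **Degree principle for symmetric polynomial optimization (Timofte, Riener).**
Let `f, g_1, …, g_m` be symmetric polynomials in `n` variables, let
`r = max {2, ⌊deg f / 2⌋, deg g_1, …, deg g_m}` and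
`K = {x : g_1(x) ≥ 0, …, g_m(x) ≥ 0}`.  Then the infimum of `f` over `K` equals the
infimum of `f` over `K ∩ A_r`, where `A_r` is the set of points with at most `r` distinct
coordinates; moreover if `f` attains its minimum on `K`, it attains it at a point of
`A_r`. -/
theorem symmetric_degree_principle {n m : ℕ}
    (f : MvPolynomial (Fin n) ℝ) (g : Fin m → MvPolynomial (Fin n) ℝ)
    (hf : f.IsSymmetric) (hg : ∀ i, (g i).IsSymmetric)
    (r : ℕ)
    (hr : r = max 2 (max (f.totalDegree / 2) (Finset.univ.sup fun i => (g i).totalDegree)))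
    (K : Set (Fin n → ℝ))
    (hK : K = {x | ∀ i, 0 ≤ MvPolynomial.eval x (g i)})
    (A : Set (Fin n → ℝ))
    (hA : A = {x | ∃ s : Finset ℝ, s.card ≤ r ∧ ∀ i, x i ∈ s}) :
    sInf ((fun x => MvPolynomial.eval x f) '' K) =
      sInf ((fun x => MvPolynomial.eval x f) '' (K ∩ A)) ∧
    ((∃ x ∈ K, ∀ y ∈ K, MvPolynomial.eval x f ≤ MvPolynomial.eval y f) →
      ∃ x ∈ K ∩ A, ∀ y ∈ K, MvPolynomial.eval x f ≤ MvPolynomial.eval y f) := by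
  have hr2 : 2 ≤ r := by rw [hr]; exact le_max_left _ _
  have hfr : f.totalDegree / 2 ≤ r := by
    rw [hr]; exact le_trans (le_max_left _ _) (le_max_right _ _)
  have hgr : ∀ i, (g i).totalDegree ≤ r := by
    intro i
    rw [hr]
    exact le_trans (le_trans (Finset.le_sup (f := fun i => (g i).totalDegree) (Finset.mem_univ i))
      (le_max_right _ _)) (le_max_right _ _)
  have key : ∀ x ∈ K, ∃ y ∈ K ∩ A, eval y f ≤ eval x f := by
    intro x hx
    obtain ⟨y, hyc, hyf, hyE⟩ := key_claim hr2 f hf hfr x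
    refine ⟨y, ⟨?_, ?_⟩, hyf⟩
    · rw [hK] at hx ⊢
      intro i
      rw [symm_const (g i) (hg i) (hgr i) y x hyE]
      exact hx i
    · rw [hA]
      exact ⟨_, hyc, fun i => Finset.mem_image_of_mem y (Finset.mem_univ i)⟩
  constructor
  · by_cases hne : K.Nonempty
    · obtain ⟨x0, hx0⟩ := hne
      obtain ⟨y0, hy0, -⟩ := key x0 hx0
      by_cases hb : BddBelow ((fun x => MvPolynomial.eval x f) '' K)
      · have hb' : BddBelow ((fun x => MvPolynomial.eval x f) '' (K ∩ A)) :=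
          hb.mono (Set.image_mono Set.inter_subset_left)
        apply le_antisymm
        · exact csInf_le_csInf hb ⟨_, y0, hy0, rfl⟩ (Set.image_mono Set.inter_subset_left)
        · refine le_csInf ⟨_, x0, hx0, rfl⟩ ?_
          rintro _ ⟨x, hx, rfl⟩
          obtain ⟨y, hy, hyx⟩ := key x hx
          exact le_trans (csInf_le hb' ⟨y, hy, rfl⟩) hyx
      · have hb' : ¬ BddBelow ((fun x => MvPolynomial.eval x f) '' (K ∩ A)) := by
          rintro ⟨B, hB⟩
          refine hb ⟨B, ?_⟩
          rintro _ ⟨x, hx, rfl⟩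
          obtain ⟨y, hy, hyx⟩ := key x hx
          exact le_trans (hB ⟨y, hy, rfl⟩) hyx
        rw [Real.sInf_of_not_bddBelow hb, Real.sInf_of_not_bddBelow hb']
    · rw [Set.not_nonempty_iff_eq_empty] at hne
      simp [hne]
  · rintro ⟨x, hx, hmin⟩
    obtain ⟨y, hy, hyx⟩ := key x hx
    exact ⟨y, hy, fun z hz => le_trans hyx (hmin z hz)⟩
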